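/- Let q be an odd prime power. Then the reduced Euler characteristic of A_2(PGL_2(q)) satisfies 3·χ̃(A_2(PGL_2(q))) = -(q-3)(q²-1). -/

import Mathlib

/-- `PGL₂(F)`: the quotient of `GL(2,F)` by its center. -/
abbrev PGL2 (F : Type*) [Field F] :=
  Matrix.GeneralLinearGroup (Fin 2) F ⧸ Subgroup.center (Matrix.GeneralLinearGroup (Fin 2) F)

/-- `PSL₂(F)`: the image of `SL(2,F)` in `PGL₂(F)` under the natural map. -/
def PSL2 (F : Type*) [Field F] : Subgroup (PGL2 F) :=
  ((QuotientGroup.mk' (Subgroup.center (Matrix.GeneralLinearGroup (Fin 2) F))).comp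
    Matrix.SpecialLinearGroup.toGL).range

/-- A subgroup is an elementary abelian `p`-subgroup if it is isomorphic to `(ℤ/pℤ)^n`
for some `n ≥ 0`. -/
def IsElementaryAbelian (p : ℕ) {G : Type*} [Group G] (H : Subgroup G) : Prop :=
  ∃ n : ℕ, Nonempty (H ≃* Multiplicative (Fin n → ZMod p))

/-- The number of chains `E₀ < E₁ < ⋯ < E_k` of length `k` of nontrivial elementary abelian
`p`-subgroups of `G`, i.e. of strictly increasing `(k+1)`-tuples in `A_p(G)`. -/
noncomputable def apChainCount (p : ℕ) (G : Type*) [Group G] (k : ℕ) : ℕ :=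
  Nat.card {c : Fin (k + 1) → Subgroup G //
    StrictMono c ∧ ∀ i, IsElementaryAbelian p (c i) ∧ c i ≠ ⊥}

/-- The reduced Euler characteristic of the poset `A_p(G)`:
`χ̃(A_p(G)) = -1 + ∑_{k ≥ 0} (-1)^k c_k` where `c_k` is the number of chains of length `k`. -/
noncomputable def reducedEulerChar (p : ℕ) (G : Type*) [Group G] : ℤ :=
  -1 + ∑ᶠ k : ℕ, (-1 : ℤ) ^ k * (apChainCount p G k : ℤ)

theorem isElementaryAbelian_two_iff {G : Type*} [Group G] [Finite G] {H : Subgroup G} :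
    IsElementaryAbelian 2 H ↔ ∀ x ∈ H, x * x = 1 := by
  constructor
  · rintro ⟨n, ⟨e⟩⟩ x hx
    have h : (⟨x, hx⟩ : H) * ⟨x, hx⟩ = 1 := by
      apply e.injective
      rw [map_mul, map_one]
      apply Multiplicative.toAdd.injective
      funext i
      exact CharTwo.add_self_eq_zero _
    exact congrArg Subtype.val h
  · intro h
    have hsq (x : H) : x * x = 1 := Subtype.ext (h x x.2)
    let _ : CommGroup H := CommGroup.mk fun a b => by
      have hab : a * b = (a * b)⁻¹ := eq_inv_of_mul_eq_one_left (hsq _)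
      rw [hab, mul_inv_rev, ← eq_inv_of_mul_eq_one_left (hsq a),
        ← eq_inv_of_mul_eq_one_left (hsq b)]
    let _ : Module (ZMod 2) (Additive H) := AddCommGroup.zmodModule fun x => by
      rw [two_nsmul]
      exact hsq x.toMul
    exact ⟨_, ⟨AddEquiv.toMultiplicativeRight
      (Module.finBasis (ZMod 2) (Additive H)).equivFun.toAddEquiv⟩⟩

theorem orderOf_eq_two_iff_mul_self {G : Type*} [Group G] {x : G} :
    orderOf x = 2 ↔ x * x = 1 ∧ x ≠ 1 := by
  rw [orderOf_eq_prime_iff, sq]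

/-- Subgroups of order two correspond to involutions. -/
theorem card_subgroup_card_two {G : Type*} [Group G] [Finite G] (H : Subgroup G) :
    Nat.card {K : Subgroup G // K ≤ H ∧ Nat.card K = 2} =
      Nat.card {x : G // x ∈ H ∧ orderOf x = 2} := by
  symm
  refine Nat.card_eq_of_bijective (fun x => ⟨Subgroup.zpowers x.1,
    Subgroup.zpowers_le.2 x.2.1, (Nat.card_zpowers _).trans x.2.2⟩) ⟨?_, ?_⟩
  · rintro ⟨x, hx, hx2⟩ ⟨y, hy, hy2⟩ hxy
    have hxy : Subgroup.zpowers x = Subgroup.zpowers y := congrArg Subtype.val hxy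
    have hmem : x ∈ Subgroup.zpowers y := hxy ▸ Subgroup.mem_zpowers x
    classical
    rw [(isOfFinOrder_of_finite y).mem_zpowers_iff_mem_range_orderOf] at hmem
    obtain ⟨k, hk, hkx⟩ := Finset.mem_image.1 hmem
    rw [Finset.mem_range, hy2] at hk
    rw [orderOf_eq_two_iff_mul_self] at hx2
    have : k = 1 := by
      by_contra hk1
      obtain rfl : k = 0 := by lia
      exact hx2.2 (by simpa using hkx.symm)
    subst this
    exact Subtype.ext (by simpa using hkx.symm)
  · rintro ⟨K, hKH, hK⟩
    have : Fact (Nat.Prime 2) := ⟨Nat.prime_two⟩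
    obtain ⟨x, hx⟩ := exists_prime_orderOf_dvd_card' (G := K) 2 (by rw [hK])
    have hx' : orderOf (x : G) = 2 := by rw [Subgroup.orderOf_coe, hx]
    refine ⟨⟨x, hKH x.2, hx'⟩, Subtype.ext ?_⟩
    refine Subgroup.eq_of_le_of_card_ge (Subgroup.zpowers_le.2 x.2) ?_
    rw [hK, Nat.card_zpowers, hx']

/-- A four-element subgroup of exponent two, i.e. a Klein four-subgroup. -/
def IsFourSubgroup {G : Type*} [Group G] (E : Subgroup G) : Prop :=
  Nat.card E = 4 ∧ ∀ x ∈ E, x * x = 1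

theorem IsFourSubgroup.card_involutions {G : Type*} [Group G] [Finite G] {E : Subgroup G}
    (hE : IsFourSubgroup E) : Nat.card {x : G // x ∈ E ∧ orderOf x = 2} = 3 := by
  have h : {x : G | x ∈ E ∧ orderOf x = 2} = (E : Set G) \ {1} := by
    ext x
    simp only [Set.mem_ofPred_eq, orderOf_eq_two_iff_mul_self, Set.mem_sdiff, SetLike.mem_coe,
      Set.mem_singleton_iff]
    exact ⟨fun h => ⟨h.1, h.2.2⟩, fun h => ⟨h.1, hE.2 x h.1, h.2⟩⟩
  change {x : G | x ∈ E ∧ orderOf x = 2}.ncard = 3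
  have hc : (E : Set G).ncard = 4 := hE.1
  rw [h, Set.ncard_sdiff_singleton_of_mem E.one_mem, hc]

/-- A pair of involutions whose product is an involution, i.e. a pair of distinct commuting
involutions. -/
def IsInvolutionPair {G : Type*} [Group G] (p : G × G) : Prop :=
  orderOf p.1 = 2 ∧ orderOf p.2 = 2 ∧ orderOf (p.1 * p.2) = 2

theorem IsFourSubgroup.card_involutionPairs {G : Type*} [Group G] [Finite G] {E : Subgroup G}
    (hE : IsFourSubgroup E) :
    Nat.card {p : G × G // (p.1 ∈ E ∧ p.2 ∈ E) ∧ IsInvolutionPair p} = 6 := by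
  classical
  have := Fintype.ofFinite G
  have h3 := hE.card_involutions
  rw [Nat.card_eq_fintype_card, Fintype.card_subtype] at h3
  set S := Finset.univ.filter fun x : G => x ∈ E ∧ orderOf x = 2 with hS
  have h : Finset.univ.filter (fun p : G × G => (p.1 ∈ E ∧ p.2 ∈ E) ∧ IsInvolutionPair p) =
      S.offDiag := by
    ext ⟨x, y⟩
    simp only [IsInvolutionPair, orderOf_eq_two_iff_mul_self, Finset.mem_filter, Finset.mem_univ, true_and,
      Finset.mem_offDiag, hS]
    constructor
    · rintro ⟨⟨hx, hy⟩, hx2, hy2, hxy2, hxy⟩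
      refine ⟨⟨hx, hx2⟩, ⟨hy, hy2⟩, ?_⟩
      rintro rfl
      exact hxy hx2.1
    · rintro ⟨⟨hx, hx2⟩, ⟨hy, hy2⟩, hxy⟩
      refine ⟨⟨hx, hy⟩, hx2, hy2, hE.2 _ (E.mul_mem hx hy), fun h => hxy ?_⟩
      rw [eq_inv_of_mul_eq_one_left h, ← eq_inv_of_mul_eq_one_left hy2.1]
  rw [Nat.card_eq_fintype_card, Fintype.card_subtype, h, Finset.offDiag_card, h3]

theorem IsInvolutionPair.existsUnique_isFourSubgroup {G : Type*} [Group G] [Finite G]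
    {p : G × G} (hp : IsInvolutionPair p) :
    ∃! E : Subgroup G, IsFourSubgroup E ∧ p.1 ∈ E ∧ p.2 ∈ E := by
  obtain ⟨x, y⟩ := p
  simp only [IsInvolutionPair, orderOf_eq_two_iff_mul_self] at hp
  obtain ⟨⟨hxx, hx⟩, ⟨hyy, hy⟩, hxyxy, hxy⟩ := hp
  have hxi : x⁻¹ = x := (eq_inv_of_mul_eq_one_left hxx).symm
  have hyi : y⁻¹ = y := (eq_inv_of_mul_eq_one_left hyy).symm
  have hyx : y * x = x * y := by
    rw [eq_inv_of_mul_eq_one_left hxyxy, mul_inv_rev, hxi, hyi]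
  have hne : x ≠ y := by
    rintro rfl
    exact hxy hxx
  have hcard : ({1, x, y, x * y} : Set G).ncard = 4 := by
    have h1 : x ≠ x * y := fun h => hy (by simpa using h.symm)
    have h2 : y ≠ x * y := fun h => hx (by simpa using h.symm)
    rw [Set.ncard_insert_of_notMem (by simp [hx.symm, hy.symm, hxy.symm]),
      Set.ncard_insert_of_notMem (by simp [hne, h1]), Set.ncard_pair h2]
  have e1 : x * (x * y) = y := by rw [← mul_assoc, hxx, one_mul]
  have e2 : y * (x * y) = x := by rw [← hyx, ← mul_assoc, hyy, one_mul]
  have e3 : x * y * x = y := by rw [mul_assoc, hyx, e1]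
  have e4 : x * y * y = x := by rw [mul_assoc, hyy, mul_one]
  let V : Subgroup G :=
    { carrier := {1, x, y, x * y}
      one_mem' := by simp
      mul_mem' := by
        rintro a b (rfl | rfl | rfl | rfl) (rfl | rfl | rfl | rfl) <;>
          simp [*]
      inv_mem' := by
        rintro a (rfl | rfl | rfl | rfl) <;> simp [hxi, hyi, hyx] }
  refine ⟨V, ⟨⟨hcard, ?_⟩, ?_, ?_⟩, ?_⟩
  · rintro a (rfl | rfl | rfl | rfl) <;> simp [*]
  · exact Or.inr (Or.inl rfl)
  · exact Or.inr (Or.inr (Or.inl rfl))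
  · rintro E ⟨hE, hxE, hyE⟩
    refine (Subgroup.eq_of_le_of_card_ge ?_ (hE.1.trans hcard.symm).le).symm
    rintro a (rfl | rfl | rfl | rfl)
    exacts [E.one_mem, hxE, hyE, E.mul_mem hxE hyE]

theorem card_involutionPairs {G : Type*} [Group G] [Finite G] :
    Nat.card {p : G × G // IsInvolutionPair p} =
      6 * Nat.card {E : Subgroup G // IsFourSubgroup E} := by
  have := Fintype.ofFinite {E : Subgroup G // IsFourSubgroup E}
  have h : Nat.card (Σ E : {E : Subgroup G // IsFourSubgroup E},
      {p : G × G // (p.1 ∈ E.1 ∧ p.2 ∈ E.1) ∧ IsInvolutionPair p}) =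
      Nat.card {p : G × G // IsInvolutionPair p} := by
    refine Nat.card_eq_of_bijective (fun s => ⟨s.2.1, s.2.2.2⟩) ⟨?_, ?_⟩
    · rintro ⟨⟨E, hE⟩, p, hpE, hp⟩ ⟨⟨E', hE'⟩, p', hpE', hp'⟩ h
      obtain rfl : p = p' := congrArg Subtype.val h
      obtain rfl := hp.existsUnique_isFourSubgroup.unique ⟨hE, hpE⟩ ⟨hE', hpE'⟩
      rfl
    · rintro ⟨p, hp⟩
      obtain ⟨E, ⟨hE, hpE⟩, -⟩ := hp.existsUnique_isFourSubgroup
      exact ⟨⟨⟨E, hE⟩, p, hpE, hp⟩, rfl⟩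
  rw [← h, Nat.card_sigma, Finset.sum_congr rfl fun E _ => E.2.card_involutionPairs]
  simp [mul_comm]

theorem isElementaryAbelian_two_and_ne_bot_iff {G : Type*} [Group G] [Finite G]
    (hG : ∀ H : Subgroup G, (∀ x ∈ H, x * x = 1) → Nat.card H ≤ 4) {H : Subgroup G} :
    IsElementaryAbelian 2 H ∧ H ≠ ⊥ ↔ Nat.card H = 2 ∨ IsFourSubgroup H := by
  constructor
  · rintro ⟨hH, hne⟩
    have hsq := isElementaryAbelian_two_iff.1 hH
    have hle := hG H hsq
    obtain ⟨n, ⟨e⟩⟩ := hH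
    have hc : Nat.card H = 2 ^ n := by simp [Nat.card_congr e.toEquiv]
    have h1 := (Subgroup.one_lt_card_iff_ne_bot H).2 hne
    have hn : n < 3 := (Nat.pow_lt_pow_iff_right (a := 2) (by norm_num)).1 (by lia)
    interval_cases n
    · lia
    · exact Or.inl hc
    · exact Or.inr ⟨hc, hsq⟩
  · intro h
    have h1 : 1 < Nat.card H := by rcases h with h | h <;> 
      [lia; exact h.1 ▸ (by norm_num : 1 < 4)]
    refine ⟨isElementaryAbelian_two_iff.2 ?_, (Subgroup.one_lt_card_iff_ne_bot H).1 h1⟩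
    rcases h with h | h
    · intro x hx
      have := pow_card_eq_one' (x := (⟨x, hx⟩ : H))
      rw [h, sq] at this
      exact congrArg Subtype.val this
    · exact h.2

theorem card_mul_two_le_of_lt {G : Type*} [Group G] [Finite G] {H K : Subgroup G} (h : H < K) :
    2 * Nat.card H ≤ Nat.card K := by
  have hlt : Nat.card H < Nat.card K := by
    by_contra hc
    exact h.ne (Subgroup.eq_of_le_of_card_ge h.le (not_lt.1 hc))
  obtain ⟨m, hm⟩ := Subgroup.card_dvd_of_le h.le
  have : 2 ≤ m := by
    by_contra hc
    interval_cases m <;> lia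
  rw [hm]
  nlinarith

theorem apChainCount_zero {G : Type*} [Group G] [Finite G]
    (hG : ∀ H : Subgroup G, (∀ x ∈ H, x * x = 1) → Nat.card H ≤ 4) :
    apChainCount 2 G 0 = Nat.card {x : G // orderOf x = 2} +
      Nat.card {E : Subgroup G // IsFourSubgroup E} := by
  classical
  have h1 : apChainCount 2 G 0 =
      Nat.card {H : Subgroup G // Nat.card H = 2 ∨ IsFourSubgroup H} := by
    refine Nat.card_congr ((Equiv.funUnique (Fin 1) (Subgroup G)).subtypeEquiv fun c => ?_)
    rw [← isElementaryAbelian_two_and_ne_bot_iff hG]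
    exact ⟨fun h => h.2 0, fun h => ⟨Subsingleton.strictMono (α := Fin 1) c, fun i => by
      rw [Subsingleton.elim (α := Fin 1) i 0]
      exact h⟩⟩
  have h2 := card_subgroup_card_two (⊤ : Subgroup G)
  simp only [le_top, Subgroup.mem_top, true_and] at h2
  have hd : Disjoint (fun H : Subgroup G => Nat.card H = 2) IsFourSubgroup := by
    rw [Pi.disjoint_iff]
    intro H
    rw [Prop.disjoint_iff]
    rintro ⟨h, h'⟩
    have := h'.1
    lia
  rw [h1, Nat.card_congr (subtypeOrEquiv _ _ hd), Nat.card_sum, h2]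

theorem apChainCount_one {G : Type*} [Group G] [Finite G]
    (hG : ∀ H : Subgroup G, (∀ x ∈ H, x * x = 1) → Nat.card H ≤ 4) :
    apChainCount 2 G 1 = 3 * Nat.card {E : Subgroup G // IsFourSubgroup E} := by
  have := Fintype.ofFinite {E : Subgroup G // IsFourSubgroup E}
  have h : Nat.card (Σ E : {E : Subgroup G // IsFourSubgroup E},
      {K : Subgroup G // K ≤ E.1 ∧ Nat.card K = 2}) = apChainCount 2 G 1 := by
    refine Nat.card_eq_of_bijective (fun s => ⟨![s.2.1, s.1.1], ?_, ?_⟩) ⟨?_, ?_⟩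
    · obtain ⟨⟨E, hE⟩, K, hKE, hK⟩ := s
      rw [Fin.strictMono_iff_lt_succ]
      intro i
      fin_cases i
      refine lt_of_le_of_ne hKE fun h => ?_
      have h : K = E := h
      have := hE.1
      rw [← h, hK] at this
      lia
    · intro i
      rw [isElementaryAbelian_two_and_ne_bot_iff hG]
      fin_cases i
      exacts [Or.inl s.2.2.2, Or.inr s.1.2]
    · rintro ⟨⟨E, hE⟩, K, hKE, hK⟩ ⟨⟨E', hE'⟩, K', hKE', hK'⟩ h
      have h := congrArg Subtype.val h
      obtain rfl : K = K' := congrFun h 0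
      obtain rfl : E = E' := congrFun h 1
      rfl
    · rintro ⟨c, hc, hA⟩
      simp only [isElementaryAbelian_two_and_ne_bot_iff hG] at hA
      have hlt : c 0 < c 1 := hc (by simp)
      have hle := card_mul_two_le_of_lt hlt
      have h0 : Nat.card (c 0) = 2 := by
        rcases hA 0 with h | h
        · exact h
        · have := h.1
          rcases hA 1 with h' | h'
          · lia
          · have := h'.1
            lia
      have h1 : IsFourSubgroup (c 1) := by
        rcases hA 1 with h | h
        · lia
        · exact h
      refine ⟨⟨⟨c 1, h1⟩, c 0, hlt.le, h0⟩, Subtype.ext ?_⟩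
      funext i
      fin_cases i <;> rfl
  rw [← h, Nat.card_sigma, Finset.sum_congr rfl fun E _ =>
    (card_subgroup_card_two E.1).trans E.2.card_involutions]
  simp [mul_comm]

theorem apChainCount_of_two_le {G : Type*} [Group G] [Finite G]
    (hG : ∀ H : Subgroup G, (∀ x ∈ H, x * x = 1) → Nat.card H ≤ 4) {k : ℕ} (hk : 2 ≤ k) :
    apChainCount 2 G k = 0 := by
  refine @Nat.card_of_isEmpty _ ⟨?_⟩
  rintro ⟨c, hc, hA⟩
  have h01 := card_mul_two_le_of_lt (hc (show (⟨0, by lia⟩ : Fin (k + 1)) < ⟨1, by lia⟩ from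
    Nat.zero_lt_one))
  have h12 := card_mul_two_le_of_lt (hc (show (⟨1, by lia⟩ : Fin (k + 1)) < ⟨2, by lia⟩ from
    Nat.one_lt_two))
  have h0 := (Subgroup.one_lt_card_iff_ne_bot _).2 (hA ⟨0, by lia⟩).2
  have h2 := hG _ (isElementaryAbelian_two_iff.1 (hA ⟨2, by lia⟩).1)
  lia

/-- The reduced Euler characteristic of `A₂(G)` for a finite group `G` of `2`-rank at most two. -/
theorem reducedEulerChar_two_of_card_le_four {G : Type*} [Group G] [Finite G]
    (hG : ∀ H : Subgroup G, (∀ x ∈ H, x * x = 1) → Nat.card H ≤ 4) :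
    3 * reducedEulerChar 2 G = -3 + 3 * (Nat.card {x : G // orderOf x = 2} : ℤ) -
      Nat.card {p : G × G // IsInvolutionPair p} := by
  have hs : (Function.support fun k : ℕ => (-1 : ℤ) ^ k * (apChainCount 2 G k : ℤ)) ⊆
      (Finset.range 2 : Finset ℕ) := by
    intro k hk
    by_contra hk2
    exact hk (by simp [apChainCount_of_two_le hG (k := k) (by simpa [Nat.succ_le_iff] using hk2)])
  rw [reducedEulerChar, finsum_eq_sum_of_support_subset _ hs, Finset.sum_range_succ,
    Finset.sum_range_one, apChainCount_zero hG, apChainCount_one hG, card_involutionPairs]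
  push_cast
  ring

section PGL2

variable {F : Type*} [Field F]

theorem PGL2.mk_eq_one_iff {M : Matrix.GeneralLinearGroup (Fin 2) F} :
    (QuotientGroup.mk M : PGL2 F) = 1 ↔ M.1 0 1 = 0 ∧ M.1 1 0 = 0 ∧ M.1 0 0 = M.1 1 1 := by
  rw [QuotientGroup.eq_one_iff, Matrix.GeneralLinearGroup.mem_center_iff_val_mem_range_scalar]
  constructor
  · rintro ⟨a, ha⟩
    rw [← ha]
    simp
  · rintro ⟨h1, h2, h3⟩
    refine ⟨M.1 0 0, ?_⟩
    ext i j
    fin_cases i <;> fin_cases j <;> simp [h1, h2, h3]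

theorem det_fin_two_ne_zero (M : Matrix.GeneralLinearGroup (Fin 2) F) :
    M.1 0 0 * M.1 1 1 - M.1 0 1 * M.1 1 0 ≠ 0 := by
  rw [← Matrix.det_fin_two]
  exact M.det_ne_zero

/-- For odd characteristic, the involutions of `PGL₂(F)` are the classes of traceless matrices. -/
theorem PGL2.orderOf_mk_eq_two_iff (h2 : (2 : F) ≠ 0) {M : Matrix.GeneralLinearGroup (Fin 2) F} :
    orderOf (QuotientGroup.mk M : PGL2 F) = 2 ↔ M.1 0 0 + M.1 1 1 = 0 := by
  have hdet := det_fin_two_ne_zero M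
  rw [orderOf_eq_two_iff_mul_self, ← QuotientGroup.mk_mul, mk_eq_one_iff, Ne, mk_eq_one_iff]
  simp only [Units.val_mul, Matrix.mul_apply, Fin.sum_univ_two]
  constructor
  · rintro ⟨⟨h01, h10, h00⟩, hne⟩
    by_contra ht
    refine hne ⟨?_, ?_, ?_⟩
    · exact (mul_eq_zero.1 (by linear_combination h01 :
        M.1 0 1 * (M.1 0 0 + M.1 1 1) = 0)).resolve_right ht
    · exact (mul_eq_zero.1 (by linear_combination h10 :
        M.1 1 0 * (M.1 0 0 + M.1 1 1) = 0)).resolve_right ht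
    · exact sub_eq_zero.1 ((mul_eq_zero.1 (by linear_combination h00 :
        (M.1 0 0 - M.1 1 1) * (M.1 0 0 + M.1 1 1) = 0)).resolve_right ht)
  · intro ht
    refine ⟨⟨by linear_combination M.1 0 1 * ht, by linear_combination M.1 1 0 * ht,
      by linear_combination (M.1 0 0 - M.1 1 1) * ht⟩, ?_⟩
    rintro ⟨h01, h10, h00⟩
    have : 2 * M.1 1 1 = 0 := by linear_combination ht - h00
    have h11 := (mul_eq_zero.1 this).resolve_left h2
    exact hdet (by rw [h01, h11]; ring)

/-- The `2`-rank of `PGL₂(F)` is at most two in odd characteristic. -/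
theorem PGL2.card_le_four [Finite F] (h2 : (2 : F) ≠ 0) (H : Subgroup (PGL2 F))
    (hH : ∀ x ∈ H, x * x = 1) : Nat.card H ≤ 4 := by
  by_contra! hc
  have hcard : Nat.card H = (H : Set (PGL2 F)).ncard := rfl
  have key (s : Finset (PGL2 F)) (hs : s.card ≤ 4) : ∃ x ∈ H, x ∉ s := by
    refine Set.exists_mem_notMem_of_ncard_lt_ncard (s := (s : Set (PGL2 F))) ?_
    rw [Set.ncard_coe_finset]
    lia
  classical
  obtain ⟨x, hx, hx1⟩ := key {1} (by simp)
  obtain ⟨y, hy, hy1⟩ := key {1, x} (Finset.card_le_two.trans (by lia))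
  obtain ⟨z, hz, hz1⟩ := key {1, x, y, x * y} Finset.card_le_four
  simp only [Finset.mem_insert, Finset.mem_singleton, not_or] at hx1 hy1 hz1
  have eq_of_mul {a b : PGL2 F} (hb : b ∈ H) (h : a * b = 1) : a = b := by
    rw [eq_inv_of_mul_eq_one_left h, ← eq_inv_of_mul_eq_one_left (hH b hb)]
  have ord {a : PGL2 F} (ha : a ∈ H) (h : a ≠ 1) : orderOf a = 2 :=
    orderOf_eq_two_iff_mul_self.2 ⟨hH a ha, h⟩
  have hxyH := H.mul_mem hx hy
  have ox := ord hx hx1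
  have oy := ord hy hy1.1
  have oz := ord hz hz1.1
  have oxy := ord hxyH fun h => hy1.2 (eq_of_mul hy h).symm
  have oxz := ord (H.mul_mem hx hz) fun h => hz1.2.1 (eq_of_mul hz h).symm
  have oyz := ord (H.mul_mem hy hz) fun h => hz1.2.2.1 (eq_of_mul hz h).symm
  have oxyz := ord (H.mul_mem hxyH hz) fun h => hz1.2.2.2 (eq_of_mul hz h).symm
  obtain ⟨X, rfl⟩ := QuotientGroup.mk_surjective x
  obtain ⟨Y, rfl⟩ := QuotientGroup.mk_surjective y
  obtain ⟨Z, rfl⟩ := QuotientGroup.mk_surjective z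
  have dX := det_fin_two_ne_zero X
  have dY := det_fin_two_ne_zero Y
  have dZ := det_fin_two_ne_zero Z
  simp only [← QuotientGroup.mk_mul, orderOf_mk_eq_two_iff h2, Units.val_mul, Matrix.mul_apply,
    Fin.sum_univ_two] at ox oy oz oxy oxz oyz oxyz
  generalize X.1 0 0 = a, X.1 0 1 = b, X.1 1 0 = c, X.1 1 1 = a' at *
  generalize Y.1 0 0 = d, Y.1 0 1 = e, Y.1 1 0 = f, Y.1 1 1 = d' at *
  generalize Z.1 0 0 = k, Z.1 0 1 = l, Z.1 1 0 = m, Z.1 1 1 = k' at *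
  obtain rfl := eq_neg_of_add_eq_zero_right ox
  obtain rfl := eq_neg_of_add_eq_zero_right oy
  obtain rfl := eq_neg_of_add_eq_zero_right oz
  have hprod : 2 * 2 * ((a * -a - b * c) * (d * -d - e * f) * (k * -k - l * m)) = 0 := by
    grind
  simp_all

/-- The negative of the determinant form on traceless `2 × 2` matrices `!![a, b; c, -a]`. -/
def tracelessForm (v : F × F × F) : F := v.1 ^ 2 + v.2.1 * v.2.2

/-- The trace form on traceless `2 × 2` matrices. -/
def tracelessPolar (v : F × F × F) : F × F × F →ₗ[F] F where
  toFun w := 2 * v.1 * w.1 + v.2.1 * w.2.2 + v.2.2 * w.2.1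
  map_add' w w' := by simp only [Prod.fst_add, Prod.snd_add]; ring
  map_smul' t w := by simp only [Prod.smul_fst, Prod.smul_snd, smul_eq_mul, RingHom.id_apply]; ring

theorem tracelessPolar_comm (v w : F × F × F) : tracelessPolar v w = tracelessPolar w v := by
  simp only [tracelessPolar, LinearMap.coe_mk, AddHom.coe_mk]
  ring

theorem tracelessPolar_ne_zero (h2 : (2 : F) ≠ 0) {v : F × F × F} (hv : v ≠ 0) :
    tracelessPolar v ≠ 0 := by
  obtain ⟨a, b, c⟩ := v
  intro h
  have ha := LinearMap.congr_fun h (1, 0, 0)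
  have hb := LinearMap.congr_fun h (0, 0, 1)
  have hc := LinearMap.congr_fun h (0, 1, 0)
  simp [tracelessPolar, h2] at ha hb hc
  exact hv (by simp [ha, hb, hc])

/-- Two orthogonal isotropic vectors are proportional. -/
theorem exists_smul_eq_of_isotropic {v w : F × F × F} (hv : v ≠ 0)
    (hQv : tracelessForm v = 0) (hQw : tracelessForm w = 0) (h : tracelessPolar v w = 0) :
    ∃ t : F, t • v = w := by
  obtain ⟨d, e, f⟩ := v
  obtain ⟨a, b, c⟩ := w
  simp only [tracelessForm, tracelessPolar, LinearMap.coe_mk, AddHom.coe_mk] at hQv hQw h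
  simp only [Prod.smul_mk, smul_eq_mul, Prod.mk.injEq]
  by_cases hf : f = 0
  · subst hf
    obtain rfl : d = 0 := by simpa using hQv
    have he : e ≠ 0 := by
      rintro rfl
      exact hv rfl
    obtain rfl : c = 0 := by simpa [he] using h
    obtain rfl : a = 0 := by simpa using hQw
    exact ⟨b / e, by simp, by field_simp, by simp⟩
  · have h1 : (a * f - d * c) ^ 2 = 0 := by
      linear_combination f ^ 2 * hQw + c ^ 2 * hQv - c * f * h
    have h1 : a * f = d * c := sub_eq_zero.1 (pow_eq_zero_iff (two_ne_zero) |>.1 h1)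
    have h3 : f * (b * f - c * e) = 0 := by
      linear_combination f * h - 2 * c * hQv - 2 * d * h1
    have h3 := (mul_eq_zero.1 h3).resolve_left hf
    refine ⟨c / f, ?_, ?_, ?_⟩
    · field_simp
      linear_combination -h1
    · field_simp
      linear_combination -h3
    · field_simp

theorem tracelessForm_zero : tracelessForm (0 : F × F × F) = 0 := by
  simp [tracelessForm]

theorem tracelessForm_smul (t : F) (v : F × F × F) :
    tracelessForm (t • v) = t ^ 2 * tracelessForm v := by
  simp only [tracelessForm, Prod.smul_fst, Prod.smul_snd, smul_eq_mul]
  ring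

theorem tracelessPolar_self (v : F × F × F) : tracelessPolar v v = 2 * tracelessForm v := by
  simp only [tracelessForm, tracelessPolar, LinearMap.coe_mk, AddHom.coe_mk]
  ring

section Counting

variable [Fintype F]

open Classical in
theorem card_tracelessForm_eq_zero :
    (Finset.univ.filter fun v : F × F × F => tracelessForm v = 0).card = Fintype.card F ^ 2 := by
  rw [sq, ← Fintype.card_prod, ← Finset.card_univ]
  refine Finset.card_nbij' (fun v => if v.2.2 = 0 then (v.2.1, 0) else (v.1, v.2.2))
    (fun p => if p.2 = 0 then (0, p.1, 0) else (p.1, -p.1 ^ 2 / p.2, p.2)) ?_ ?_ ?_ ?_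
  · simp
  · rintro ⟨u, t⟩ -
    rw [Finset.mem_coe, Finset.mem_filter]
    by_cases ht : t = 0 <;> simp [ht, tracelessForm]
  · rintro ⟨a, b, c⟩ h
    replace h : a ^ 2 + b * c = 0 := (Finset.mem_filter.1 h).2
    by_cases hc : c = 0
    · subst hc
      obtain rfl : a = 0 := by simpa using h
      simp
    · simp only [hc, if_false, Prod.mk.injEq, true_and, and_true]
      field_simp
      linear_combination -h
  · rintro ⟨u, t⟩ -
    by_cases ht : t = 0 <;> simp [ht]

open Classical in
theorem card_tracelessForm_ne_zero :
    ((Finset.univ.filter fun v : F × F × F => tracelessForm v ≠ 0).card : ℤ) =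
      (Fintype.card F : ℤ) ^ 3 - (Fintype.card F : ℤ) ^ 2 := by
  have h := Finset.card_filter_add_card_filter_not (s := (Finset.univ : Finset (F × F × F)))
    (fun v => tracelessForm v = 0)
  rw [card_tracelessForm_eq_zero, Finset.card_univ, Fintype.card_prod, Fintype.card_prod] at h
  zify at h
  linear_combination h

open Classical in
theorem card_tracelessPolar_eq_zero (h2 : (2 : F) ≠ 0) {v : F × F × F} (hv : v ≠ 0) :
    (Finset.univ.filter fun w : F × F × F => tracelessPolar v w = 0).card =
      Fintype.card F ^ 2 := by
  have hker : Module.finrank F (LinearMap.ker (tracelessPolar v)) = 2 := by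
    have h := (tracelessPolar v).finrank_range_add_finrank_ker
    rw [LinearMap.range_eq_top.2 (LinearMap.surjective (tracelessPolar_ne_zero h2 hv))] at h
    simp at h
    lia
  have h := Module.card_eq_pow_finrank (K := F) (V := LinearMap.ker (tracelessPolar v))
  rw [hker] at h
  rw [← h, Fintype.card_subtype]
  simp

open Classical in
theorem card_isotropic_orthogonal {v : F × F × F} (hv : v ≠ 0)
    (hQv : tracelessForm v = 0) :
    (Finset.univ.filter fun w : F × F × F => tracelessPolar v w = 0 ∧ tracelessForm w = 0).card =
      Fintype.card F := by
  rw [← Finset.card_univ, ← Finset.card_image_of_injective Finset.univ (smul_left_injective F hv)]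
  congr 1
  ext w
  simp only [Finset.mem_filter, Finset.mem_univ, true_and, Finset.mem_image]
  constructor
  · rintro ⟨h, hw⟩
    exact exists_smul_eq_of_isotropic hv hQv hw h
  · rintro ⟨t, rfl⟩
    rw [map_smul, tracelessPolar_self, tracelessForm_smul, hQv]
    simp

open Classical in
theorem card_anisotropic_orthogonal (h2 : (2 : F) ≠ 0) {v : F × F × F} (hv : v ≠ 0)
    (hQv : tracelessForm v = 0) :
    ((Finset.univ.filter fun w : F × F × F =>
      tracelessPolar v w = 0 ∧ tracelessForm w ≠ 0).card : ℤ) =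
      (Fintype.card F : ℤ) ^ 2 - Fintype.card F := by
  have h := Finset.card_filter_add_card_filter_not
    (s := Finset.univ.filter fun w : F × F × F => tracelessPolar v w = 0)
    (fun w => tracelessForm w = 0)
  rw [Finset.filter_filter, Finset.filter_filter, card_isotropic_orthogonal hv hQv,
    card_tracelessPolar_eq_zero h2 hv] at h
  zify at h
  linear_combination h

open Classical in
theorem card_anisotropic_orthogonal_pairs (h2 : (2 : F) ≠ 0) :
    ((Finset.univ.filter fun p : (F × F × F) × (F × F × F) => tracelessForm p.1 ≠ 0 ∧
      tracelessForm p.2 ≠ 0 ∧ tracelessPolar p.1 p.2 = 0).card : ℤ) =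
      ((Fintype.card F : ℤ) - 1) ^ 2 *
        ((Fintype.card F : ℤ) ^ 3 - Fintype.card F) := by
  set q : ℤ := (Fintype.card F : ℤ) with hq
  set A := Finset.univ.filter fun v : F × F × F => tracelessForm v ≠ 0 with hA
  set Z := Finset.univ.filter fun v : F × F × F => tracelessForm v = 0 with hZ
  have hsplit (v : F × F × F) :
      (Z.filter fun w => tracelessPolar v w = 0).card +
        (A.filter fun w => tracelessPolar v w = 0).card =
      (Finset.univ.filter fun w => tracelessPolar v w = 0).card := by
    rw [hZ, hA, Finset.filter_comm, Finset.filter_comm (p := fun v => tracelessForm v ≠ 0)]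
    exact Finset.card_filter_add_card_filter_not _
  have h1 : Finset.univ.filter (fun p : (F × F × F) × (F × F × F) => tracelessForm p.1 ≠ 0 ∧
      tracelessForm p.2 ≠ 0 ∧ tracelessPolar p.1 p.2 = 0) =
      (A ×ˢ A).filter fun p => tracelessPolar p.1 p.2 = 0 := by
    ext p
    simp [hA, and_assoc]
  have h3 : ((A ×ˢ A).filter fun p => tracelessPolar p.1 p.2 = 0).card =
      ∑ v ∈ A, (A.filter fun w => tracelessPolar v w = 0).card := by
    simp only [Finset.card_filter, Finset.sum_product]
  have h4 : ∑ v ∈ A, (Z.filter fun w => tracelessPolar v w = 0).card =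
      ∑ w ∈ Z, (Finset.univ.filter fun v : F × F × F =>
        tracelessPolar w v = 0 ∧ tracelessForm v ≠ 0).card := by
    simp only [Finset.card_filter]
    rw [Finset.sum_comm]
    refine Finset.sum_congr rfl fun w _ => ?_
    rw [hA, Finset.sum_filter]
    refine Finset.sum_congr rfl fun v _ => ?_
    rw [tracelessPolar_comm v w]
    split_ifs <;> simp_all
  have h5 : ∑ v ∈ A, ((Z.filter fun w => tracelessPolar v w = 0).card : ℤ) +
      ∑ v ∈ A, ((A.filter fun w => tracelessPolar v w = 0).card : ℤ) = (q ^ 3 - q ^ 2) * q ^ 2 := by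
    rw [← Finset.sum_add_distrib, ← card_tracelessForm_ne_zero, ← nsmul_eq_mul,
      ← Finset.sum_const]
    refine Finset.sum_congr rfl fun v hv => ?_
    have hv0 : v ≠ 0 := by
      rintro rfl
      exact (Finset.mem_filter.1 hv).2 tracelessForm_zero
    rw [hq]
    exact_mod_cast (hsplit v).trans (card_tracelessPolar_eq_zero h2 hv0)
  have h6 : ∑ w ∈ Z, ((Finset.univ.filter fun v : F × F × F =>
      tracelessPolar w v = 0 ∧ tracelessForm v ≠ 0).card : ℤ) =
      (q ^ 3 - q ^ 2) + (q ^ 2 - 1) * (q ^ 2 - q) := by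
    have h0 : (0 : F × F × F) ∈ Z := by simp [hZ, tracelessForm_zero]
    rw [← Finset.add_sum_erase Z _ h0]
    congr 1
    · rw [← card_tracelessForm_ne_zero]
      congr 2
      ext v
      simp [tracelessPolar_comm 0 v]
    · have hc : ((Z.erase 0).card : ℤ) = q ^ 2 - 1 := by
        rw [Finset.card_erase_of_mem h0, Nat.cast_sub (Finset.card_pos.2 ⟨0, h0⟩), hZ,
          card_tracelessForm_eq_zero]
        simp [hq]
      rw [← hc, ← nsmul_eq_mul, ← Finset.sum_const]
      refine Finset.sum_congr rfl fun v hv => ?_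
      rw [Finset.mem_erase, hZ, Finset.mem_filter] at hv
      exact card_anisotropic_orthogonal h2 hv.1 hv.2.2
  rw [h1, h3]
  zify at h4
  push_cast
  linear_combination h5 - h4 - h6

end Counting

/-- The invertible matrix `!![a, b; c, -a]`. -/
def tracelessGL (v : {v : F × F × F // tracelessForm v ≠ 0}) :
    Matrix.GeneralLinearGroup (Fin 2) F :=
  Matrix.GeneralLinearGroup.mkOfDetNeZero !![v.1.1, v.1.2.1; v.1.2.2, -v.1.1] (by
    rw [Matrix.det_fin_two_of]
    exact fun h => v.2 (by rw [tracelessForm]; linear_combination -h))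

theorem tracelessGL_val (v : {v : F × F × F // tracelessForm v ≠ 0}) :
    (tracelessGL v).1 = !![v.1.1, v.1.2.1; v.1.2.2, -v.1.1] := rfl

theorem tracelessGL_injective : Function.Injective (tracelessGL (F := F)) := by
  rintro ⟨⟨a, b, c⟩, h⟩ ⟨⟨a', b', c'⟩, h'⟩ hM
  have hM := congrArg Units.val hM
  rw [tracelessGL_val, tracelessGL_val] at hM
  have h1 := congrFun (congrFun hM 0) 0
  have h2 := congrFun (congrFun hM 0) 1
  have h3 := congrFun (congrFun hM 1) 0
  simp at h1 h2 h3
  simp [h1, h2, h3]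

theorem exists_tracelessGL_eq {M : Matrix.GeneralLinearGroup (Fin 2) F}
    (hM : M.1 0 0 + M.1 1 1 = 0) : ∃ v, tracelessGL v = M := by
  have hdet := det_fin_two_ne_zero M
  have h11 : -M.1 0 0 = M.1 1 1 := by linear_combination -hM
  refine ⟨⟨(M.1 0 0, M.1 0 1, M.1 1 0), fun h => hdet ?_⟩, Units.ext ?_⟩
  · rw [tracelessForm] at h
    linear_combination M.1 0 0 * hM - h
  · rw [tracelessGL_val]
    ext i j
    fin_cases i <;> fin_cases j <;> simp [h11]

theorem PGL2.orderOf_mk_tracelessGL (h2 : (2 : F) ≠ 0)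
    (v : {v : F × F × F // tracelessForm v ≠ 0}) :
    orderOf (QuotientGroup.mk (tracelessGL v) : PGL2 F) = 2 := by
  rw [orderOf_mk_eq_two_iff h2, tracelessGL_val]
  simp

theorem PGL2.isInvolutionPair_mk_tracelessGL_iff (h2 : (2 : F) ≠ 0)
    (v w : {v : F × F × F // tracelessForm v ≠ 0}) :
    IsInvolutionPair ((QuotientGroup.mk (tracelessGL v) : PGL2 F),
      (QuotientGroup.mk (tracelessGL w) : PGL2 F)) ↔ tracelessPolar v.1 w.1 = 0 := by
  rw [IsInvolutionPair, and_iff_right (orderOf_mk_tracelessGL h2 v),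
    and_iff_right (orderOf_mk_tracelessGL h2 w), ← QuotientGroup.mk_mul, orderOf_mk_eq_two_iff h2]
  rw [Units.val_mul, tracelessGL_val, tracelessGL_val]
  simp only [tracelessPolar, LinearMap.coe_mk, AddHom.coe_mk]
  simp [Matrix.mul_apply, Fin.sum_univ_two]
  constructor <;> intro h <;> linear_combination h

variable [Fintype F]

theorem card_center_GL_two :
    (Nat.card (Subgroup.center (Matrix.GeneralLinearGroup (Fin 2) F)) : ℤ) =
      (Fintype.card F : ℤ) - 1 := by
  have hinj : Function.Injective 
      (Matrix.GeneralLinearGroup.scalar (Fin 2) : Fˣ →* Matrix.GeneralLinearGroup (Fin 2) F) := by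
    intro a b h
    rw [Matrix.GeneralLinearGroup.ext_iff] at h
    exact Units.ext (by simpa using h 0 0)
  rw [Matrix.GeneralLinearGroup.center_eq_range_scalar,
    Nat.card_congr (MonoidHom.ofInjective hinj).symm.toEquiv, Nat.card_units,
    Nat.cast_sub Nat.card_pos, Nat.card_eq_fintype_card, Nat.cast_one]

theorem card_preimage_mk_pairs {G : Type*} [Group G] (N : Subgroup G)
    (P : (G ⧸ N) × (G ⧸ N) → Prop) :
    Nat.card {p : G × G // P (QuotientGroup.mk p.1, QuotientGroup.mk p.2)} =
      Nat.card {x // P x} * (Nat.card N * Nat.card N) := by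
  rw [← Nat.card_prod, ← Nat.card_prod]
  let e : G ≃ (G ⧸ N) × N := Subgroup.groupEquivQuotientProdSubgroup
  have he (g : G) : (e g).1 = QuotientGroup.mk g := rfl
  refine Nat.card_eq_of_bijective
    (fun p => (⟨(QuotientGroup.mk p.1.1, QuotientGroup.mk p.1.2), p.2⟩,
      ((e p.1.1).2, (e p.1.2).2))) ⟨?_, ?_⟩
  · rintro ⟨⟨a, b⟩, h⟩ ⟨⟨a', b'⟩, h'⟩ heq
    simp only [Prod.mk.injEq, Subtype.mk.injEq] at heq
    obtain ⟨⟨h1, h2⟩, h3, h4⟩ := heq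
    have ha : a = a' := e.injective (Prod.ext h1 h3)
    have hb : b = b' := e.injective (Prod.ext h2 h4)
    simp [ha, hb]
  · rintro ⟨⟨⟨x, y⟩, h⟩, n, m⟩
    have hx : (QuotientGroup.mk (e.symm (x, n)) : G ⧸ N) = x := by rw [← he, e.apply_symm_apply]
    have hy : (QuotientGroup.mk (e.symm (y, m)) : G ⧸ N) = y := by rw [← he, e.apply_symm_apply]
    refine ⟨⟨(e.symm (x, n), e.symm (y, m)), ?_⟩, ?_⟩
    · simpa only [hx, hy] using h
    · simp [hx, hy]

theorem PGL2.card_involutions (h2 : (2 : F) ≠ 0) (h1 : (Fintype.card F : ℤ) - 1 ≠ 0) :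
    (Nat.card {x : PGL2 F // orderOf x = 2} : ℤ) = (Fintype.card F : ℤ) ^ 2 := by
  classical
  have h3 := Nat.card_congr (QuotientGroup.preimageMkEquivSubgroupProdSet
    (Subgroup.center (Matrix.GeneralLinearGroup (Fin 2) F)) {x : PGL2 F | orderOf x = 2})
  have h4 : Nat.card {v : F × F × F // tracelessForm v ≠ 0} = Nat.card ((QuotientGroup.mk :
      Matrix.GeneralLinearGroup (Fin 2) F → PGL2 F) ⁻¹' {x : PGL2 F | orderOf x = 2}) := by
    refine Nat.card_eq_of_bijective (fun v => ⟨tracelessGL v, orderOf_mk_tracelessGL h2 v⟩)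
      ⟨fun v w h => tracelessGL_injective (congrArg Subtype.val h), ?_⟩
    rintro ⟨M, hM⟩
    obtain ⟨v, rfl⟩ := exists_tracelessGL_eq ((orderOf_mk_eq_two_iff h2).1 hM)
    exact ⟨v, rfl⟩
  have h5 := card_tracelessForm_ne_zero (F := F)
  rw [← Fintype.card_subtype, ← Nat.card_eq_fintype_card, h4, h3, Nat.card_prod, Nat.cast_mul,
    card_center_GL_two] at h5
  refine mul_left_cancel₀ h1 (h5.trans ?_)
  ring

theorem PGL2.card_involutionPairs (h2 : (2 : F) ≠ 0) (h1 : (Fintype.card F : ℤ) - 1 ≠ 0) :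
    (Nat.card {p : PGL2 F × PGL2 F // IsInvolutionPair p} : ℤ) =
      (Fintype.card F : ℤ) ^ 3 - Fintype.card F := by
  classical
  have h3 := card_preimage_mk_pairs (Subgroup.center (Matrix.GeneralLinearGroup (Fin 2) F))
    (IsInvolutionPair (G := PGL2 F))
  have h4 : Nat.card {p : (F × F × F) × (F × F × F) // tracelessForm p.1 ≠ 0 ∧
      tracelessForm p.2 ≠ 0 ∧ tracelessPolar p.1 p.2 = 0} =
      Nat.card {p : Matrix.GeneralLinearGroup (Fin 2) F × Matrix.GeneralLinearGroup (Fin 2) F //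
        IsInvolutionPair ((QuotientGroup.mk p.1 : PGL2 F), (QuotientGroup.mk p.2 : PGL2 F))} := by
    refine Nat.card_eq_of_bijective
      (fun p => ⟨(tracelessGL ⟨p.1.1, p.2.1⟩, tracelessGL ⟨p.1.2, p.2.2.1⟩),
        (isInvolutionPair_mk_tracelessGL_iff h2 _ _).2 p.2.2.2⟩) ⟨?_, ?_⟩
    · rintro ⟨⟨v, w⟩, h⟩ ⟨⟨v', w'⟩, h'⟩ heq
      simp only [Subtype.mk.injEq, Prod.mk.injEq] at heq
      have hv := congrArg Subtype.val (tracelessGL_injective heq.1)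
      have hw := congrArg Subtype.val (tracelessGL_injective heq.2)
      exact Subtype.ext (Prod.ext hv hw)
    · rintro ⟨⟨M, N⟩, h⟩
      obtain ⟨v, rfl⟩ := exists_tracelessGL_eq ((orderOf_mk_eq_two_iff h2).1 h.1)
      obtain ⟨w, rfl⟩ := exists_tracelessGL_eq ((orderOf_mk_eq_two_iff h2).1 h.2.1)
      exact ⟨⟨(v.1, w.1), v.2, w.2, (isInvolutionPair_mk_tracelessGL_iff h2 v w).1 h⟩, rfl⟩
  have h5 := card_anisotropic_orthogonal_pairs h2
  rw [← Fintype.card_subtype, ← Nat.card_eq_fintype_card, h4, h3, Nat.cast_mul, Nat.cast_mul,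
    card_center_GL_two] at h5
  refine mul_left_cancel₀ (pow_ne_zero 2 h1) (Eq.trans ?_ h5)
  ring

end PGL2

/-- For an odd prime power `q`: `3·χ̃(A₂(PGL₂(q))) = -(q-3)(q²-1)`. -/
theorem reducedEulerChar_PGL2 (q : ℕ) (hq : IsPrimePow q) (hodd : Odd q)
    (F : Type*) [Field F] [Fintype F] (hF : Fintype.card F = q) :
    3 * reducedEulerChar 2 (PGL2 F) = -(((q : ℤ) - 3) * ((q : ℤ) ^ 2 - 1)) := by
  have h2 : (2 : F) ≠ 0 := by
    refine Ring.two_ne_zero fun h => ?_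
    have := FiniteField.even_card_of_char_two h
    rw [hF] at this
    have := Nat.odd_iff.1 hodd
    lia
  have h1 : (Fintype.card F : ℤ) - 1 ≠ 0 := by
    have := Fintype.one_lt_card (α := F)
    lia
  have : Finite (PGL2 F) := Quotient.finite _
  rw [reducedEulerChar_two_of_card_le_four (PGL2.card_le_four h2), PGL2.card_involutions h2 h1,
    PGL2.card_involutionPairs h2 h1, hF]
  ring
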